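/- Let X and Y be real Banach spaces, let p ∈ [1, ∞), and suppose there exists a map f : X → Y which is weakly sequentially continuous, coarse, and satisfies Property (*). If Y is p-asymptotically uniformly convex, i.e. there exists K > 0 with δ̄_Y(t) ≥ K·t^p for all t ∈ [0, 1], then X has the p-co-Banach-Saks property. -/

import Mathlib

open Filter

/-- A map between normed spaces is *coarse* if points at distance at most `t`
are mapped to points at uniformly bounded distance. -/
def Coarse {X Y : Type*} [NormedAddCommGroup X] [NormedAddCommGroup Y]
    (f : X → Y) : Prop :=
  ∀ t : ℝ, 0 ≤ t → ∃ C : ℝ, ∀ x y : X, ‖x - y‖ ≤ t → ‖f x - f y‖ ≤ C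

/-- Property (*): there are `0 < α < β` and `b > 0` such that points at distance
in `[α, β]` are mapped to points at distance at least `b`. -/
def PropertyStar {X Y : Type*} [NormedAddCommGroup X] [NormedAddCommGroup Y]
    (f : X → Y) : Prop :=
  ∃ α β b : ℝ, 0 < α ∧ α < β ∧ 0 < b ∧
    ∀ x y : X, α ≤ ‖x - y‖ → ‖x - y‖ ≤ β → b ≤ ‖f x - f y‖

/-- A map is weakly sequentially continuous if it sends weakly convergent
sequences to weakly convergent sequences. -/
def WeakSeqCont {X Y : Type*} [NormedAddCommGroup X] [NormedSpace ℝ X]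
    [NormedAddCommGroup Y] [NormedSpace ℝ Y] (f : X → Y) : Prop :=
  ∀ (x : ℕ → X) (x₀ : X),
    (∀ φ : X →L[ℝ] ℝ, Tendsto (fun n => φ (x n)) atTop (nhds (φ x₀))) →
    ∀ ψ : Y →L[ℝ] ℝ, Tendsto (fun n => ψ (f (x n))) atTop (nhds (ψ (f x₀)))

/-- The modulus of asymptotic uniform convexity `δ̄_Y(t)`. -/
noncomputable def AUCmod (Y : Type*) [NormedAddCommGroup Y] [NormedSpace ℝ Y] (t : ℝ) : ℝ :=
  sInf { r : ℝ | ∃ x : Y, ‖x‖ = 1 ∧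
    r = sSup { s : ℝ | ∃ E : Subspace ℝ Y, IsClosed (E : Set Y) ∧
      FiniteDimensional ℝ (Y ⧸ E) ∧
      s = sInf { u : ℝ | ∃ y : Y, y ∈ E ∧ ‖y‖ = 1 ∧ u = ‖x + t • y‖ - 1 } } }

/-- `(e_n)` in `S` is a spreading model of the bounded sequence `(x_n)` in `X`. -/
def IsSpreadingModel {X S : Type*} [NormedAddCommGroup X] [NormedSpace ℝ X]
    [NormedAddCommGroup S] [NormedSpace ℝ S] (x : ℕ → X) (e : ℕ → S) : Prop :=
  ∀ ε : ℝ, 0 < ε → ∀ k : ℕ, ∃ ℓ : ℕ, ∀ n : Fin k → ℕ,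
    StrictMono n → (∀ i, ℓ ≤ n i) → ∀ a : Fin k → ℝ, (∀ i, |a i| ≤ 1) →
      |‖∑ i, a i • x (n i)‖ - ‖∑ i, a i • e (i : ℕ)‖| ≤ ε

universe v

/-- `X` has the `p`-co-Banach-Saks property. -/
def pCoBanachSaks (X : Type*) [NormedAddCommGroup X] [NormedSpace ℝ X] (p : ℝ) : Prop :=
  ∃ C : ℝ, 0 < C ∧
    ∀ x : ℕ → X, (∀ n, ‖x n‖ = 1) →
      (∀ φ : X →L[ℝ] ℝ, Tendsto (fun n => φ (x n)) atTop (nhds 0)) →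
      ∀ (S : Type v) [NormedAddCommGroup S] [NormedSpace ℝ S] [CompleteSpace S]
        (e : ℕ → S), IsSpreadingModel x e →
        ∀ k : ℕ, C * (k : ℝ) ^ (1 / p) ≤ ‖∑ i : Fin k, e (i : ℕ)‖

/-- A coarse map grows at most linearly. -/
lemma Coarse.exists_linear_bound {X Y : Type*} [NormedAddCommGroup X] [NormedSpace ℝ X]
    [NormedAddCommGroup Y] {f : X → Y} (hf : Coarse f) :
    ∃ M : ℝ, 0 ≤ M ∧ ∀ u : X, ‖f u - f 0‖ ≤ M * (‖u‖ + 1) := by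
  obtain ⟨M, hM⟩ := hf 1 zero_le_one
  have hM0 : 0 ≤ M := (norm_nonneg _).trans (hM 0 0 (by simp))
  have key : ∀ (m : ℕ) (u : X), ‖u‖ ≤ m → ‖f u - f 0‖ ≤ m * M := by
    intro m
    induction m with
    | zero =>
      intro u hu
      have : u = 0 := norm_le_zero_iff.1 (by simpa using hu)
      simp [this]
    | succ m ih =>
      intro u hu
      have hm : (0 : ℝ) < m + 1 := by positivity
      push_cast at hu ⊢
      have h1 : ‖((m : ℝ) / (m + 1)) • u‖ ≤ m := by
        rw [norm_smul, Real.norm_of_nonneg (by positivity), div_mul_eq_mul_div, div_le_iff₀ hm]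
        gcongr
      have h2 : ‖u - ((m : ℝ) / (m + 1)) • u‖ ≤ 1 := by
        have : u - ((m : ℝ) / (m + 1)) • u = (1 / (m + 1) : ℝ) • u := by
          rw [show (1 / (m + 1) : ℝ) = 1 - m / (m + 1) by field_simp; ring, sub_smul, one_smul]
        rw [this, norm_smul, Real.norm_of_nonneg (by positivity), div_mul_eq_mul_div,
          div_le_iff₀ hm]
        simpa using hu
      have h3 := norm_add_le (f u - f (((m : ℝ) / (m + 1)) • u))
        (f (((m : ℝ) / (m + 1)) • u) - f 0)
      rw [sub_add_sub_cancel] at h3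
      linarith [ih _ h1, hM _ _ h2]
  refine ⟨M, hM0, fun u => (key ⌈‖u‖⌉₊ u (Nat.le_ceil _)).trans ?_⟩
  rw [mul_comm]
  exact mul_le_mul_of_nonneg_left (Nat.ceil_lt_add_one (norm_nonneg u)).le hM0

/-- Lower semicontinuity of the norm along a translate of a weakly null sequence. -/
lemma eventually_lt_norm_add_of_weakly_null {X : Type*} [NormedAddCommGroup X] [NormedSpace ℝ X]
    {z : ℕ → X} (hz : ∀ φ : X →L[ℝ] ℝ, Tendsto (fun n => φ (z n)) atTop (nhds 0))
    {u : X} {r : ℝ} (hr : r < ‖u‖) : ∀ᶠ n in atTop, r < ‖u + z n‖ := by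
  obtain ⟨φ, hφ, hφu⟩ := exists_dual_vector'' ℝ u
  have h : Tendsto (fun n => φ (u + z n)) atTop (nhds ‖u‖) := by
    simpa [hφu] using (hz φ).const_add (φ u)
  filter_upwards [h.eventually_const_lt hr] with n hn
  calc r < φ (u + z n) := hn
    _ ≤ ‖φ (u + z n)‖ := Real.le_norm_self _
    _ ≤ ‖φ‖ * ‖u + z n‖ := φ.le_opNorm _
    _ ≤ ‖u + z n‖ := mul_le_of_le_one_left (norm_nonneg _) hφ

/-- A weakly null sequence approaches every closed subspace of finite codimension. -/
lemma eventually_exists_mem_norm_sub_lt {Y : Type*} [NormedAddCommGroup Y] [NormedSpace ℝ Y]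
    {y : ℕ → Y} (hy : ∀ φ : Y →L[ℝ] ℝ, Tendsto (fun n => φ (y n)) atTop (nhds 0))
    (E : Subspace ℝ Y) (hE : IsClosed (E : Set Y)) [FiniteDimensional ℝ (Y ⧸ E)]
    {ε : ℝ} (hε : 0 < ε) : ∀ᶠ n in atTop, ∃ z ∈ E, ‖y n - z‖ < ε := by
  have : IsClosed (E : Set Y) := hE
  let e := (Module.finBasis ℝ (Y ⧸ E)).equivFunL
  have h1 : Tendsto (fun n => e (E.mkQL (y n))) atTop (nhds 0) := by
    rw [tendsto_pi_nhds]
    intro i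
    exact hy ((ContinuousLinearMap.proj (R := ℝ) (φ := fun _ => ℝ) i).comp
      (e.toContinuousLinearMap.comp E.mkQL))
  have h2 : Tendsto (fun n => E.mkQL (y n)) atTop (nhds 0) := by
    simpa [Function.comp_def] using (e.symm.continuous.tendsto 0).comp h1
  have h3 := h2.norm
  rw [norm_zero] at h3
  filter_upwards [h3.eventually_lt_const hε] with n hn
  obtain ⟨m, hm, hmε⟩ := Submodule.Quotient.norm_mk_lt (S := E) (E.mkQL (y n))
    (sub_pos.2 hn)
  refine ⟨y n - m, ?_, ?_⟩
  · rw [← Submodule.Quotient.eq]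
    exact hm.symm
  · rw [sub_sub_cancel]
    linarith

/-- A lower bound on the modulus of asymptotic uniform convexity is witnessed by a subspace
of finite codimension, for all vectors of norm at least `t`. -/
lemma exists_subspace_of_lt_AUCmod {Y : Type*} [NormedAddCommGroup Y] [NormedSpace ℝ Y]
    {t δ : ℝ} (ht : 0 < t) (hδ : 0 ≤ δ) (h : δ < AUCmod Y t) {w : Y} (hw : ‖w‖ = 1) :
    ∃ E : Subspace ℝ Y, IsClosed (E : Set Y) ∧ FiniteDimensional ℝ (Y ⧸ E) ∧
      ∀ z ∈ E, t ≤ ‖z‖ → 1 + δ ≤ ‖w + z‖ := by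
  let B : Y → Subspace ℝ Y → Set ℝ := fun x E =>
    {u : ℝ | ∃ y : Y, y ∈ E ∧ ‖y‖ = 1 ∧ u = ‖x + t • y‖ - 1}
  let A : Y → Set ℝ := fun x => {s : ℝ | ∃ E : Subspace ℝ Y, IsClosed (E : Set Y) ∧
      FiniteDimensional ℝ (Y ⧸ E) ∧ s = sInf (B x E)}
  have hB : ∀ x E, ∀ u ∈ B x E, -1 ≤ u := by
    rintro x E u ⟨y, -, -, rfl⟩
    linarith [norm_nonneg (x + t • y)]
  have hBinf : ∀ x E, -1 ≤ sInf (B x E) := by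
    intro x E
    rcases (B x E).eq_empty_or_nonempty with h | h
    · rw [h, Real.sInf_empty]
      norm_num
    · exact le_csInf h (hB x E)
  have hAne : ∀ x, (A x).Nonempty := fun x =>
    ⟨_, ⊤, isClosed_univ, Module.Finite.of_surjective (0 : ℝ →ₗ[ℝ] (Y ⧸ (⊤ : Subspace ℝ Y)))
      fun _ => ⟨0, Subsingleton.elim _ _⟩, rfl⟩
  have hA : ∀ x, -1 ≤ sSup (A x) := by
    intro x
    by_cases hb : BddAbove (A x)
    · obtain ⟨s, hs⟩ := hAne x
      refine le_trans ?_ (le_csSup hb hs)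
      obtain ⟨E, -, -, rfl⟩ := hs
      exact hBinf x E
    · rw [Real.sSup_of_not_bddAbove hb]
      norm_num
  have hle : AUCmod Y t ≤ sSup (A w) := by
    refine csInf_le ⟨-1, ?_⟩ ⟨w, hw, rfl⟩
    rintro r ⟨x, -, rfl⟩
    exact hA x
  obtain ⟨s, ⟨E, hE, hfin, rfl⟩, hs⟩ := exists_lt_of_lt_csSup (hAne w) (h.trans_le hle)
  refine ⟨E, hE, hfin, fun z hz htz => ?_⟩
  have hz0 : 0 < ‖z‖ := ht.trans_le htz
  have h1 : sInf (B w E) ≤ ‖w + t • (‖z‖⁻¹ • z)‖ - 1 :=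
    csInf_le ⟨-1, hB w E⟩
      ⟨‖z‖⁻¹ • z, E.smul_mem _ hz, by rw [norm_smul, norm_inv, norm_norm, inv_mul_cancel₀ hz0.ne'],
        rfl⟩
  set a : ℝ := t * ‖z‖⁻¹ with ha
  have ha0 : 0 < a := by positivity
  have ha1 : a ≤ 1 := by
    rw [ha, ← div_eq_mul_inv, div_le_one hz0]
    exact htz
  have h2 : w + t • (‖z‖⁻¹ • z) = (1 - a) • w + a • (w + z) := by
    rw [smul_smul]
    module
  have h3 := norm_add_le ((1 - a) • w) (a • (w + z))
  rw [← h2, norm_smul, norm_smul, hw, Real.norm_of_nonneg (sub_nonneg.2 ha1),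
    Real.norm_of_nonneg ha0.le] at h3
  by_contra! hcon
  nlinarith

/-- Lower `p`-estimate for weakly null perturbations in a `p`-asymptotically uniformly
convex space. -/
lemma eventually_rpow_norm_add_ge {Y : Type*} [NormedAddCommGroup Y] [NormedSpace ℝ Y]
    {p K b : ℝ} (hp : 1 ≤ p) (hK : 0 < K) (hb : 0 < b)
    (hAUC : ∀ t ∈ Set.Icc (0 : ℝ) 1, K * t ^ p ≤ AUCmod Y t)
    {y : ℕ → Y} (hy : ∀ φ : Y →L[ℝ] ℝ, Tendsto (fun n => φ (y n)) atTop (nhds 0))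
    (hyb : ∀ n, b ≤ ‖y n‖) {v : Y} (hv : b ≤ ‖v‖) :
    ∀ᶠ n in atTop, ‖v‖ ≤ ‖v + y n‖ ∧ ‖v‖ ^ p + K * (b / 2) ^ p / 4 ≤ ‖v + y n‖ ^ p := by
  have hv0 : 0 < ‖v‖ := hb.trans_le hv
  set t : ℝ := b / 2 / ‖v‖ with ht
  have ht0 : 0 < t := by positivity
  have ht1 : t ≤ 1 := by
    rw [ht, div_le_one hv0]
    linarith
  set δ : ℝ := K * t ^ p / 2 with hδ
  have htp : 0 < t ^ p := Real.rpow_pos_of_pos ht0 p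
  have hδ0 : 0 < δ := by positivity
  have hδlt : δ < AUCmod Y t := by
    refine lt_of_lt_of_le ?_ (hAUC t ⟨ht0.le, ht1⟩)
    rw [hδ]
    linarith [mul_pos hK htp]
  have hw : ‖‖v‖⁻¹ • v‖ = 1 := by rw [norm_smul, norm_inv, norm_norm, inv_mul_cancel₀ hv0.ne']
  obtain ⟨E, hE, hfin, hEz⟩ := exists_subspace_of_lt_AUCmod ht0 hδ0.le hδlt hw
  have hε : 0 < ‖v‖ * min t (δ / 2) := by positivity
  filter_upwards [eventually_exists_mem_norm_sub_lt hy E hE hε] with n ⟨z, hz, hzn⟩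
  have hz1 : ‖y n - z‖ < b / 2 := by
    refine hzn.trans_le ((mul_le_mul_of_nonneg_left (min_le_left _ _) hv0.le).trans_eq ?_)
    rw [ht]
    field_simp
  have hz2 : ‖y n - z‖ < ‖v‖ * (δ / 2) :=
    hzn.trans_le (mul_le_mul_of_nonneg_left (min_le_right _ _) hv0.le)
  have hzb : b / 2 ≤ ‖z‖ := by
    have := norm_sub_norm_le (y n) z
    linarith [hyb n]
  have h1 := hEz (‖v‖⁻¹ • z) (E.smul_mem _ hz) (by
    rw [norm_smul, norm_inv, norm_norm, ht, div_eq_inv_mul]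
    gcongr)
  rw [← smul_add, norm_smul, norm_inv, norm_norm, ← div_eq_inv_mul, le_div_iff₀ hv0] at h1
  have h2 : ‖v + z‖ ≤ ‖v + y n‖ + ‖y n - z‖ := by
    have := norm_sub_le (v + y n) (y n - z)
    rwa [show v + y n - (y n - z) = v + z by abel] at this
  have h3 : ‖v‖ * (1 + δ / 2) ≤ ‖v + y n‖ := by linarith
  refine ⟨by nlinarith, ?_⟩
  calc ‖v‖ ^ p + K * (b / 2) ^ p / 4 = ‖v‖ ^ p * (1 + 1 * (δ / 2)) := by
        have : t ^ p = (b / 2) ^ p / ‖v‖ ^ p := Real.div_rpow (by positivity) hv0.le p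
        have hvp : 0 < ‖v‖ ^ p := Real.rpow_pos_of_pos hv0 p
        rw [hδ, this]
        field_simp
        ring
    _ ≤ ‖v‖ ^ p * (1 + p * (δ / 2)) := by gcongr
    _ ≤ ‖v‖ ^ p * (1 + δ / 2) ^ p := by
        gcongr
        exact one_add_mul_self_le_rpow_one_add (by linarith) hp
    _ = (‖v‖ * (1 + δ / 2)) ^ p := (Real.mul_rpow hv0.le (by positivity)).symm
    _ ≤ ‖v + y n‖ ^ p := by gcongr

/-- Greedy selection of a strictly increasing tuple of indices whose partial sums inductively
satisfy a property that is eventually preserved. -/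
lemma exists_strictMono_sum_of_eventually {X : Type*} [AddCommMonoid X] {z : ℕ → X}
    {P : ℕ → X → Prop} (h0 : ∀ᶠ n in atTop, P 0 (z n))
    (hP : ∀ j u, P j u → ∀ᶠ n in atTop, P (j + 1) (u + z n)) (N k : ℕ) :
    ∃ n : Fin (k + 1) → ℕ, StrictMono n ∧ (∀ i, N ≤ n i) ∧ P k (∑ i, z (n i)) := by
  induction k with
  | zero =>
    obtain ⟨m, hm, hNm⟩ := (h0.and (eventually_ge_atTop N)).exists
    exact ⟨fun _ => m, fun i j hij => absurd hij (by omega), fun _ => hNm, by simpa using hm⟩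
  | succ k ih =>
    obtain ⟨n, hn, hNn, hPn⟩ := ih
    obtain ⟨m, ⟨hm, hNm⟩, hlt⟩ := (((hP k _ hPn).and (eventually_ge_atTop N)).and
      (eventually_gt_atTop (n (Fin.last k)))).exists
    refine ⟨Fin.snoc n m, ?_, ?_, ?_⟩
    · intro i j hij
      induction j using Fin.lastCases with
      | last =>
        obtain ⟨i, rfl⟩ := Fin.exists_castSucc_eq.2 hij.ne
        simpa using (hn.monotone (Fin.le_last i)).trans_lt hlt
      | cast j =>
        obtain ⟨i, rfl⟩ := Fin.exists_castSucc_eq.2 (hij.trans (Fin.castSucc_lt_last j)).ne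
        simpa using hn (Fin.castSucc_lt_castSucc_iff.1 hij)
    · intro i
      induction i using Fin.lastCases with
      | last => simpa using hNm
      | cast i => simpa using hNn i
    · simpa [Fin.sum_univ_castSucc] using hm

/-- Corollary 1.4: if `f : X → Y` is weakly sequentially continuous,
coarse and satisfies Property (*), and `Y` is `p`-asymptotically uniformly convex, then
`X` has the `p`-co-Banach-Saks property. -/
theorem stmt1 {X Y : Type*} [NormedAddCommGroup X] [NormedSpace ℝ X] [CompleteSpace X]
    [NormedAddCommGroup Y] [NormedSpace ℝ Y] [CompleteSpace Y]
    (p : ℝ) (hp : 1 ≤ p)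
    (f : X → Y) (hwsc : WeakSeqCont f) (hcoarse : Coarse f) (hstar : PropertyStar f)
    (hAUC : ∃ K : ℝ, 0 < K ∧ ∀ t ∈ Set.Icc (0 : ℝ) 1, K * t ^ p ≤ AUCmod Y t) :
    pCoBanachSaks.{v} X p := by
  obtain ⟨α, β, b, hα, hαβ, hb, hstar⟩ := hstar
  obtain ⟨K, hK, hAUC⟩ := hAUC
  obtain ⟨M, hM, hfM⟩ := hcoarse.exists_linear_bound
  have hp0 : 0 < p := zero_lt_one.trans_le hp
  set c : ℝ := min (b ^ p) (K * (b / 2) ^ p / 4) with hc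
  have hc0 : 0 < c := by
    have := Real.rpow_pos_of_pos hb p
    have := Real.rpow_pos_of_pos (half_pos hb) p
    positivity
  set L : ℝ := M * (α + 2) + 1 with hL
  have hL0 : 0 < L := by positivity
  have hcp : 0 < c ^ (1 / p) := Real.rpow_pos_of_pos hc0 _
  refine ⟨c ^ (1 / p) / L, by positivity, ?_⟩
  intro x hx hxw S _ _ _ e he k
  rcases k with _ | k
  · simp [Real.zero_rpow (inv_pos.2 hp0).ne']
  set z : ℕ → X := fun n => α • x n with hz
  have hzn : ∀ n, ‖z n‖ = α := fun n => by
    rw [hz, norm_smul, hx, mul_one, Real.norm_of_nonneg hα.le]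
  have hzw : ∀ φ : X →L[ℝ] ℝ, Tendsto (fun n => φ (z n)) atTop (nhds 0) := fun φ => by
    simpa [hz] using (hxw φ).const_mul α
  have hyb : ∀ u n, b ≤ ‖f (u + z n) - f u‖ := fun u n =>
    hstar _ _ (by simp [hzn]) (by simpa [hzn] using hαβ.le)
  have hyw : ∀ u, ∀ ψ : Y →L[ℝ] ℝ,
      Tendsto (fun n => ψ (f (u + z n) - f u)) atTop (nhds 0) := fun u ψ => by
    have := hwsc (fun n => u + z n) u (fun φ => by simpa using (hzw φ).const_add (φ u)) ψ
    simpa using this.sub_const (ψ (f u))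
  have hsel := exists_strictMono_sum_of_eventually (z := z)
    (P := fun j u => α / 2 < ‖u‖ ∧ b ≤ ‖f u - f 0‖ ∧ ((j : ℝ) + 1) * c ≤ ‖f u - f 0‖ ^ p)
    (by
      refine Eventually.of_forall fun n => ?_
      have h1 : b ≤ ‖f (z n) - f 0‖ := by simpa using hyb 0 n
      refine ⟨by rw [hzn]; linarith, h1, ?_⟩
      have : b ^ p ≤ ‖f (z n) - f 0‖ ^ p := by gcongr
      rw [Nat.cast_zero, zero_add, one_mul]
      exact (min_le_left _ _).trans this)
    (by
      rintro j u ⟨hu, hub, huc⟩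
      filter_upwards [eventually_lt_norm_add_of_weakly_null hzw hu,
        eventually_rpow_norm_add_ge hp hK hb hAUC (hyw u) (hyb u) hub] with n h1 h2
      rw [add_comm (f u - f 0), sub_add_sub_cancel] at h2
      refine ⟨h1, hub.trans h2.1, ?_⟩
      push_cast
      linarith [h2.2, min_le_right (b ^ p) (K * (b / 2) ^ p / 4)])
  have hbound : ∀ ε : ℝ, 0 < ε →
      c ^ (1 / p) / L * ((k + 1 : ℕ) : ℝ) ^ (1 / p) ≤ ‖∑ i : Fin (k + 1), e (i : ℕ)‖ + ε := by
    intro ε hε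
    obtain ⟨N, hN⟩ := he ε hε (k + 1)
    obtain ⟨n, hn, hNn, hu, -, huc⟩ := hsel N k
    have h1 := hN n hn hNn (fun _ => 1) (by simp)
    simp only [one_smul] at h1
    have hsum : ‖∑ i, z (n i)‖ = α * ‖∑ i, x (n i)‖ := by
      rw [hz, ← Finset.smul_sum, norm_smul, Real.norm_of_nonneg hα.le]
    have h2 : c ^ (1 / p) * ((k + 1 : ℕ) : ℝ) ^ (1 / p) ≤ ‖f (∑ i, z (n i)) - f 0‖ := by
      rw [← Real.mul_rpow hc0.le (by positivity), one_div,
        Real.rpow_inv_le_iff_of_pos (by positivity) (norm_nonneg _) hp0]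
      push_cast
      linarith
    have h3 := hfM (∑ i, z (n i))
    rw [hsum] at h3 hu
    have hx2 : 1 ≤ 2 * ‖∑ i, x (n i)‖ := by nlinarith
    have h4 : M * (α * ‖∑ i, x (n i)‖ + 1) ≤ L * ‖∑ i, x (n i)‖ := by
      rw [hL]
      nlinarith [mul_le_mul_of_nonneg_left hx2 hM]
    have h5 := (abs_le.1 h1).2
    rw [div_mul_eq_mul_div, div_le_iff₀ hL0]
    calc _ ≤ L * ‖∑ i, x (n i)‖ := h2.trans (h3.trans h4)
      _ ≤ L * (‖∑ i : Fin (k + 1), e (i : ℕ)‖ + ε) := by gcongr; linarith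
      _ = _ := mul_comm _ _
  exact le_of_forall_pos_le_add hbound
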